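/- (7/144) · S^⧢(Gr_4) = 8 · Alt_8[ ( [ρ_{2,4}/ρ_{3,4}] ⊗ [1 − ρ_{2,4}/ρ_{3,4}] − [1 − ρ_{2,4}/ρ_{3,4}] ⊗ [ρ_{2,4}/ρ_{3,4}] ) ⊗ [ρ_{1,2}] ⊗ [ρ_1/ρ_4] ] in V_F^{⊗4}. -/

import Mathlib

open scoped TensorProduct
open PiTensorProduct

attribute [local instance] Classical.propDecidable

set_option maxHeartbeats 1000000
set_option synthInstance.maxHeartbeats 400000

noncomputable section

namespace GrassPoly

variable (F : Type) [Field F]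

/-- `V_F = F^× ⊗_ℤ ℚ` as a `ℚ`-vector space. -/
abbrev VF : Type := ℚ ⊗[ℤ] (Additive Fˣ)

variable {F}

/-- The class `[a]` of a nonzero field element in `V_F` (defined to be `0` for `a = 0`). -/
def cls (a : F) : VF F :=
  if h : a = 0 then 0 else (1 : ℚ) ⊗ₜ[ℤ] (Additive.ofMul (Units.mk0 a h))

variable (F) in
/-- Tensor powers of V_F over ℚ. -/
abbrev TP (n : ℕ) : Type := ⨂[ℚ]^n (VF F)

instance instTPAddCommGroup (n : ℕ) : AddCommGroup (TP F n) :=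
  Module.addCommMonoidToAddCommGroup ℚ

/-- Appending one extra tensor factor on the right. -/
def snoc {n : ℕ} : TP F n →ₗ[ℚ] VF F →ₗ[ℚ] TP F (n + 1) :=
  PiTensorProduct.lift
    ((PiTensorProduct.tprod ℚ (s := fun _ : Fin (n + 1) => VF F)).curryRight)

/-- The factor `t_i` appearing in the recursive definition of the symbol,
as a function of `(a_{i-1}, a_i, a_{i+1})`. -/
def tCoef (p a q : F) : VF F :=
  if p = a then (if a = q then 0 else cls (q - a))
  else if a = q then - cls (p - a)
  else cls ((q - a) / (p - a))

/-- The symbol `S I(a₀; a₁, …, a_m; a_{m+1})`, with the middle entries given as a list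
(of length `n`). -/
def SIaux : (n : ℕ) → (a0 : F) → (as : List F) → (b : F) → as.length = n → TP F n
  | 0, _, _, _, _ => tprod ℚ (fun i : Fin 0 => i.elim0)
  | n + 1, a0, as, b, h =>
      ∑ i : Fin (n + 1),
        snoc (SIaux n a0 (as.eraseIdx i.val) b
            (by
              have hi' := i.isLt
              have hi : i.val < as.length := by omega
              have h2 := List.length_eraseIdx_of_lt hi
              omega))
          (tCoef ((a0 :: as).getD i.val 0) (as.getD i.val 0) ((as ++ [b]).getD (i.val + 1) 0))

/-- Cyclic rotation `b₁ ⊗ … ⊗ b_N ↦ b₂ ⊗ … ⊗ b_N ⊗ b₁` on tensor powers. -/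
def rotN (n : ℕ) : TP F n ≃ₗ[ℚ] TP F n :=
  PiTensorProduct.reindex ℚ (fun _ : Fin n => VF F) (finRotate n).symm

/-- Splitting off the last tensor factor. -/
def splitLast (n : ℕ) : TP F (n + 1) ≃ₗ[ℚ] (TP F n) ⊗[ℚ] (VF F) :=
  ((PiTensorProduct.reindex ℚ (fun _ : Fin (n + 1) => VF F)
      (finSumFinEquiv (m := n) (n := 1)).symm).trans
    (PiTensorProduct.tmulEquiv ℚ (VF F)).symm).trans
    (TensorProduct.congr (LinearEquiv.refl ℚ _)
      (PiTensorProduct.subsingletonEquiv (0 : Fin 1)))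

/-- The projector `Π̃_N` annihilating symbols of products. -/
def Pit : (n : ℕ) → TP F n →ₗ[ℚ] TP F n
  | 0 => LinearMap.id
  | 1 => LinearMap.id
  | (n + 2) =>
      ((splitLast (n + 1)).symm.toLinearMap
        ∘ₗ TensorProduct.map (Pit (n + 1)) LinearMap.id
        ∘ₗ (splitLast (n + 1)).toLinearMap)
      ∘ₗ ((LinearMap.id : TP F (n + 2) →ₗ[ℚ] TP F (n + 2)) - (rotN (F := F) (n + 2)).toLinearMap)

/-- The map on `V_F` induced by a field automorphism. -/
def vmap (φ : F ≃+* F) : VF F →ₗ[ℚ] VF F :=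
  TensorProduct.AlgebraTensorModule.map (LinearMap.id : ℚ →ₗ[ℚ] ℚ)
    (AddMonoidHom.toIntLinearMap
      { toFun := fun a => Additive.ofMul ((Units.map (φ : F →* F)) a.toMul)
        map_zero' := by simp
        map_add' := by intro a b; simp [_root_.map_mul] })

/-- The induced map on tensor powers. -/
def tpMap {n : ℕ} (φ : F ≃+* F) : TP F n →ₗ[ℚ] TP F n :=
  PiTensorProduct.map (fun _ => vmap φ)


/-! ### Symbols of (multiple) polylogarithms -/

/-- Symbol of `Li₂`. -/
def SLi2 (x : F) : TP F 2 := - SIaux 2 0 [x⁻¹, 0] 1 rfl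

/-- Symbol of `Li₃`. -/
def SLi3 (x : F) : TP F 3 := - SIaux 3 0 [x⁻¹, 0, 0] 1 rfl

/-- Symbol of `Li₄`. -/
def SLi4 (x : F) : TP F 4 := - SIaux 4 0 [x⁻¹, 0, 0, 0] 1 rfl

/-- Symbol of `Li₅`. -/
def SLi5 (x : F) : TP F 5 := - SIaux 5 0 [x⁻¹, 0, 0, 0, 0] 1 rfl

/-- Symbol of `I_{3,1}(x,y) = I(0; x,0,0,y; 1)`. -/
def SI31 (x y : F) : TP F 4 := SIaux 4 0 [x, 0, 0, y] 1 rfl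

/-- Symbol of `I_{4,1}(x,y) = I(0; x,0,0,0,y; 1)`. -/
def SI41 (x y : F) : TP F 5 := SIaux 5 0 [x, 0, 0, 0, y] 1 rfl

/-- Symbol of `I⁺_{4,1}(x,y) = ½ (I_{4,1}(x,y) + I_{4,1}(x,y⁻¹))`. -/
def I41p (x y : F) : TP F 5 := (2 : ℚ)⁻¹ • (SI41 x y + SI41 x y⁻¹)

/-- The anharmonic orbit of `x`, together with the signs of the
corresponding permutations in `S₃`. -/
def anhList (x : F) : List (ℚ × F) :=
  [(1, x), (1, (1 - x)⁻¹), (1, 1 - x⁻¹), (-1, x⁻¹), (-1, 1 - x), (-1, x / (x - 1))]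

/-- Symbol of `Ĩ_{3,1}(x,y) = (1/36) Σ_{σ,π ∈ S₃} sgn(σ) sgn(π) I_{3,1}(x^σ, y^π)`. -/
def tI31 (x y : F) : TP F 4 :=
  (36 : ℚ)⁻¹ •
    ((anhList x).map (fun p =>
      ((anhList y).map (fun q => (p.1 * q.1) • SI31 p.2 q.2)).sum)).sum

/-- Symbol of `Ĩ⁺_{4,1}(x,y) = (1/6) Σ_{σ ∈ S₃} sgn(σ) I⁺_{4,1}(x^σ, y)`. -/
def tI41p (x y : F) : TP F 5 :=
  (6 : ℚ)⁻¹ • ((anhList x).map (fun p => p.1 • I41p p.2 y)).sum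

/-- Symbol of `V(z; x, y) = Ĩ_{3,1}(z, [x]+[y]+[(1-x)/(1-xy)]+[1-xy]+[(1-y)/(1-xy)])`. -/
def Vc (z x y : F) : TP F 4 :=
  tI31 z x + tI31 z y + tI31 z ((1 - x) / (1 - x * y)) + tI31 z (1 - x * y)
    + tI31 z ((1 - y) / (1 - x * y))

/-- `Sym₃₆(a,b) := I_{3,1}(a,b) - Ĩ_{3,1}(a,b)` (on the level of symbols). -/
def S36 (a b : F) : TP F 4 := SI31 a b - tI31 a b

/-! ### Generic vectors -/

variable (N m : ℕ)

/-- Polynomial ring on the entries of `N` generic vectors in `m`-space. -/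
abbrev Pol : Type := MvPolynomial (Fin N × Fin m) ℚ

/-- The field of rational functions in the entries of `N` generic vectors in `m`-space. -/
abbrev FF : Type := FractionRing (Pol N m)

/-- The `j`-th coordinate of the `i`-th generic vector. -/
def gen (i : Fin N) (j : Fin m) : FF N m :=
  algebraMap (Pol N m) (FF N m) (MvPolynomial.X (i, j))

/-- `⟨i₁ … i_m⟩`: the determinant of the matrix whose columns are
the generic vectors selected by `cols`. -/
def dets (cols : Fin m → Fin N) : FF N m :=
  (Matrix.of fun r c => gen N m (cols c) r).det

/-- The field automorphism of `FF N m` induced by a permutation of the `N` vectors. -/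
def permAut (σ : Equiv.Perm (Fin N)) : FF N m ≃+* FF N m :=
  IsFractionRing.ringEquivOfRingEquiv
    ((MvPolynomial.renameEquiv ℚ (σ.prodCongr (Equiv.refl (Fin m)))).toRingEquiv)

variable {N m}

/-- Skew-symmetrization over all permutations of the `N` generic vectors. -/
def Alt {n : ℕ} (x : TP (FF N m) n) : TP (FF N m) n :=
  ∑ σ : Equiv.Perm (Fin N), (((Equiv.Perm.sign σ : ℤˣ) : ℤ) : ℚ) • tpMap (permAut N m σ) x

end GrassPoly

end

namespace GrassPoly

noncomputable section W4

/-- The field of rational functions in the entries of 8 generic vectors in 4-space. -/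
abbrev K4 : Type := FF 8 4

/-- The vector label `k ∈ {1, …, 8}` as an index. -/
def L8 (k : ℕ) : Fin 8 := ⟨(k - 1) % 8, Nat.mod_lt _ (by norm_num)⟩

/-- `⟨abcd⟩` for vector labels in `{1, …, 8}`. -/
def d4 (a b c d : ℕ) : K4 := dets 8 4 ![L8 a, L8 b, L8 c, L8 d]

/-- Vector labels taken mod 6 in `{1, …, 6}`. -/
def M6 (j : ℕ) : ℕ := (j - 1) % 6 + 1

/-- `ρ_i = ρ_{i,i+1,i+2} = ⟨i,i+1,i+2,7⟩ / ⟨i,i+1,i+2,8⟩`, indices mod 6. -/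
def rho (i : ℕ) : K4 :=
  d4 (M6 i) (M6 (i + 1)) (M6 (i + 2)) 7 / d4 (M6 i) (M6 (i + 1)) (M6 (i + 2)) 8

/-- `ρ_{i,j} = ρ_i - ρ_j`. -/
def rr (i j : ℕ) : K4 := rho i - rho j

/-- The projected cross-ratio `CR(ab|cdef) = ⟨abce⟩⟨abdf⟩ / (⟨abcf⟩⟨abde⟩)`. -/
def CR (a b c d e f : ℕ) : K4 :=
  (d4 a b c e * d4 a b d f) / (d4 a b c f * d4 a b d e)

/-- The symbol `S(Gr₄) = 2·(4!)²·Alt₈ [⟨1234⟩ ⊗ ⟨2345⟩ ⊗ ⟨3456⟩ ⊗ ⟨4567⟩]`. -/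
def SGr4 : TP K4 4 :=
  ((2 : ℚ) * ((Nat.factorial 4 : ℚ)) ^ 2) •
    Alt (tprod ℚ ![cls (d4 1 2 3 4), cls (d4 2 3 4 5), cls (d4 3 4 5 6), cls (d4 4 5 6 7)])

/-- An elementary tensor in `V_F^{⊗4}`. -/
def tp4 (a b c d : VF K4) : TP K4 4 := tprod ℚ ![a, b, c, d]

end W4

end GrassPoly

namespace GrassPoly

noncomputable section

/-! ### The class map -/

section ClassMap

variable {F : Type} [Field F]

theorem cls_mul {a b : F} (ha : a ≠ 0) (hb : b ≠ 0) : cls (a * b) = cls a + cls b := by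
  simp only [cls, ha, hb, mul_eq_zero, or_self, dite_false, ← TensorProduct.tmul_add,
    ← ofMul_mul]
  congr 2
  ext
  rfl

theorem cls_one : cls (1 : F) = 0 := by
  have h := cls_mul (one_ne_zero (α := F)) one_ne_zero
  rw [mul_one] at h
  simpa using h

theorem cls_inv (a : F) : cls a⁻¹ = -cls a := by
  by_cases ha : a = 0
  · simp [ha, cls]
  · have h := cls_mul ha (inv_ne_zero ha)
    rw [mul_inv_cancel₀ ha, cls_one] at h
    exact (neg_eq_of_add_eq_zero_right h.symm).symm

theorem cls_div {a b : F} (ha : a ≠ 0) (hb : b ≠ 0) : cls (a / b) = cls a - cls b := by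
  rw [div_eq_mul_inv, cls_mul ha (inv_ne_zero hb), cls_inv, sub_eq_add_neg]

theorem cls_neg (a : F) : cls (-a) = cls a := by
  by_cases ha : a = 0
  · simp [ha]
  · have h1 : (-1 : F) ≠ 0 := neg_ne_zero.mpr one_ne_zero
    have h := cls_mul h1 h1
    rw [neg_mul_neg, one_mul, cls_one] at h
    have h2 : (2 : ℚ) • cls (-1 : F) = 0 := by rw [two_smul]; exact h.symm
    have h3 : cls (-1 : F) = 0 := (smul_eq_zero.mp h2).resolve_left two_ne_zero
    rw [← neg_one_mul, cls_mul h1 ha, h3, zero_add]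

theorem vmap_cls (φ : F ≃+* F) (a : F) : vmap φ (cls a) = cls (φ a) := by
  by_cases ha : a = 0
  · simp [ha, cls]
  · have hb : φ a ≠ 0 := by simpa using ha
    simp only [cls, ha, hb, dite_false, vmap]
    rw [TensorProduct.AlgebraTensorModule.map_tmul]
    congr 1
    simp only [AddMonoidHom.coe_toIntLinearMap, AddMonoidHom.coe_mk, ZeroHom.coe_mk]
    congr 1
    ext
    rfl

theorem vmap_vmap (φ ψ χ : F ≃+* F) (h : ∀ a, φ (ψ a) = χ a) (v : VF F) :
    vmap φ (vmap ψ v) = vmap χ v := by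
  induction v using TensorProduct.induction_on with
  | zero => simp
  | add x y hx hy => simp only [map_add, hx, hy]
  | tmul q a =>
    simp only [vmap]
    rw [TensorProduct.AlgebraTensorModule.map_tmul, TensorProduct.AlgebraTensorModule.map_tmul,
      TensorProduct.AlgebraTensorModule.map_tmul]
    congr 1
    simp only [AddMonoidHom.coe_toIntLinearMap, AddMonoidHom.coe_mk, ZeroHom.coe_mk]
    congr 1
    ext
    exact h _

end ClassMap

/-! ### Elementary tensors of length four -/

section Quad

variable {F : Type} [Field F]

/-- An elementary tensor of length four. -/
def quad (a b c d : VF F) : TP F 4 := tprod ℚ ![a, b, c, d]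

theorem tpMap_quad (φ : F ≃+* F) (a b c d : VF F) :
    tpMap φ (quad a b c d) = quad (vmap φ a) (vmap φ b) (vmap φ c) (vmap φ d) := by
  rw [quad, tpMap, PiTensorProduct.map_tprod, quad]
  congr 1
  ext i
  fin_cases i <;> rfl

/-- `quad` as a linear map of its first slot. -/
def quadFst (b c d : VF F) : VF F →ₗ[ℚ] TP F 4 :=
  (tprod ℚ (s := fun _ : Fin 4 => VF F)).toLinearMap ![0, b, c, d] 0

theorem quadFst_apply (a b c d : VF F) : quadFst b c d a = quad a b c d := by
  rw [quadFst, MultilinearMap.toLinearMap_apply, quad]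
  congr 1
  ext i
  fin_cases i <;> rfl

/-- `quad` as a linear map of its second slot. -/
def quadSnd (a c d : VF F) : VF F →ₗ[ℚ] TP F 4 :=
  (tprod ℚ (s := fun _ : Fin 4 => VF F)).toLinearMap ![a, 0, c, d] 1

theorem quadSnd_apply (a b c d : VF F) : quadSnd a c d b = quad a b c d := by
  rw [quadSnd, MultilinearMap.toLinearMap_apply, quad]
  congr 1
  ext i
  fin_cases i <;> rfl

/-- `quad` as a linear map of its third slot. -/
def quadTrd (a b d : VF F) : VF F →ₗ[ℚ] TP F 4 :=
  (tprod ℚ (s := fun _ : Fin 4 => VF F)).toLinearMap ![a, b, 0, d] 2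

theorem quadTrd_apply (a b c d : VF F) : quadTrd a b d c = quad a b c d := by
  rw [quadTrd, MultilinearMap.toLinearMap_apply, quad]
  congr 1
  ext i
  fin_cases i <;> rfl

/-- `quad` as a linear map of its fourth slot. -/
def quadFth (a b c : VF F) : VF F →ₗ[ℚ] TP F 4 :=
  (tprod ℚ (s := fun _ : Fin 4 => VF F)).toLinearMap ![a, b, c, 0] 3

theorem quadFth_apply (a b c d : VF F) : quadFth a b c d = quad a b c d := by
  rw [quadFth, MultilinearMap.toLinearMap_apply, quad]
  congr 1
  ext i
  fin_cases i <;> rfl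

end Quad

end

end GrassPoly
namespace GrassPoly

noncomputable section

/-! ### The projector on elementary tensors -/

section Projector

variable {F : Type} [Field F]

theorem splitLast_tprod (n : ℕ) (f : Fin (n + 1) → VF F) :
    splitLast n (tprod ℚ f) = tprod ℚ (fun i => f i.castSucc) ⊗ₜ[ℚ] f (Fin.last n) := by
  simp only [splitLast, LinearEquiv.trans_apply]
  erw [PiTensorProduct.reindex_tprod, PiTensorProduct.tmulEquiv_symm_apply]
  rw [TensorProduct.congr_tmul]
  erw [PiTensorProduct.subsingletonEquiv_apply_tprod]
  rfl

theorem splitLast_symm_tmul (n : ℕ) (f : Fin n → VF F) (x : VF F) :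
    (splitLast n).symm (tprod ℚ f ⊗ₜ[ℚ] x) = tprod ℚ (Fin.snoc (α := fun _ => VF F) f x) := by
  rw [LinearEquiv.symm_apply_eq, splitLast_tprod]
  simp

theorem rotN_tprod (n : ℕ) (f : Fin n → VF F) :
    rotN n (tprod ℚ f) = tprod ℚ (fun i => f (finRotate n i)) := by
  rw [rotN]
  erw [PiTensorProduct.reindex_tprod]
  rfl

theorem Pit_succ_tprod (n : ℕ) (f : Fin (n + 2) → VF F) :
    Pit (n + 2) (tprod ℚ f) =
      (splitLast (n + 1)).symm
        (Pit (n + 1) (tprod ℚ fun i => f i.castSucc) ⊗ₜ[ℚ] f (Fin.last (n + 1))) -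
      (splitLast (n + 1)).symm
        (Pit (n + 1) (tprod ℚ fun i => f i.succ) ⊗ₜ[ℚ] f 0) := by
  simp only [Pit, LinearMap.comp_apply, LinearMap.sub_apply, LinearMap.id_apply, map_sub,
    LinearEquiv.coe_coe, rotN_tprod, splitLast_tprod, TensorProduct.map_tmul]
  simp

theorem Pit_two (a b : VF F) :
    Pit 2 (tprod ℚ ![a, b]) = tprod ℚ ![a, b] - tprod ℚ ![b, a] := by
  rw [Pit_succ_tprod]
  simp only [Pit, LinearMap.id_apply, splitLast_symm_tmul]
  congr 2 <;> ext i <;> fin_cases i <;> rfl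

theorem Pit_three (a b c : VF F) :
    Pit 3 (tprod ℚ ![a, b, c]) = tprod ℚ ![a, b, c] - tprod ℚ ![b, a, c] -
      (tprod ℚ ![b, c, a] - tprod ℚ ![c, b, a]) := by
  have h1 : (fun i : Fin 2 => (![a, b, c] : Fin 3 → VF F) i.castSucc) = ![a, b] := by
    ext i; fin_cases i <;> rfl
  have h2 : (fun i : Fin 2 => (![a, b, c] : Fin 3 → VF F) i.succ) = ![b, c] := by
    ext i; fin_cases i <;> rfl
  rw [Pit_succ_tprod, h1, h2, Pit_two, Pit_two]
  simp only [TensorProduct.sub_tmul, map_sub, splitLast_symm_tmul]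
  congr 3 <;> ext i <;> fin_cases i <;> rfl

theorem Pit_quad (a b c d : VF F) :
    Pit 4 (quad a b c d) =
      quad a b c d - quad b a c d - (quad b c a d - quad c b a d) -
        (quad b c d a - quad c b d a - (quad c d b a - quad d c b a)) := by
  have h1 : (fun i : Fin 3 => (![a, b, c, d] : Fin 4 → VF F) i.castSucc) = ![a, b, c] := by
    ext i; fin_cases i <;> rfl
  have h2 : (fun i : Fin 3 => (![a, b, c, d] : Fin 4 → VF F) i.succ) = ![b, c, d] := by
    ext i; fin_cases i <;> rfl
  rw [quad, Pit_succ_tprod, h1, h2, Pit_three, Pit_three]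
  simp only [TensorProduct.sub_tmul, map_sub, splitLast_symm_tmul, quad]
  congr 4 <;> ext i <;> fin_cases i <;> rfl

end Projector

/-! ### Skew-symmetrization -/

section Skew

variable {N m : ℕ}

theorem permAut_mul (σ τ : Equiv.Perm (Fin N)) (a : FF N m) :
    permAut N m σ (permAut N m τ a) = permAut N m (σ * τ) a := by
  have h : ((permAut N m σ).toRingHom.comp (permAut N m τ).toRingHom) =
      (permAut N m (σ * τ)).toRingHom := by
    refine IsLocalization.ringHom_ext (nonZeroDivisors (Pol N m)) ?_
    ext x
    · simp [permAut]
    · cases x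
      simp [permAut, MvPolynomial.rename_X]
  exact DFunLike.congr_fun h a

theorem vmap_permAut_mul (σ τ : Equiv.Perm (Fin N)) (v : VF (FF N m)) :
    vmap (permAut N m σ) (vmap (permAut N m τ) v) = vmap (permAut N m (σ * τ)) v :=
  vmap_vmap _ _ _ (permAut_mul σ τ) v

/-- `Alt` as a linear map. -/
def altLin (N m n : ℕ) : TP (FF N m) n →ₗ[ℚ] TP (FF N m) n :=
  ∑ σ : Equiv.Perm (Fin N), (((Equiv.Perm.sign σ : ℤˣ) : ℤ) : ℚ) • tpMap (permAut N m σ)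

theorem altLin_apply {n : ℕ} (x : TP (FF N m) n) : altLin N m n x = Alt x := by
  simp [altLin, Alt, LinearMap.sum_apply]

theorem Alt_quad_perm (τ : Equiv.Perm (Fin N)) (a b c d : VF (FF N m)) :
    Alt (quad (vmap (permAut N m τ) a) (vmap (permAut N m τ) b) (vmap (permAut N m τ) c)
      (vmap (permAut N m τ) d)) =
      (((Equiv.Perm.sign τ : ℤˣ) : ℤ) : ℚ) • Alt (quad a b c d) := by
  rw [Alt, Alt, Finset.smul_sum]
  refine Fintype.sum_equiv (Equiv.mulRight τ) _ _ fun σ => ?_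
  simp only [tpMap_quad, vmap_permAut_mul, Equiv.coe_mulRight, smul_smul]
  congr 1
  rw [Equiv.Perm.sign_mul]
  rcases Int.units_eq_one_or (Equiv.Perm.sign τ) with h | h <;> simp [h]

theorem Alt_quad_swap {i j : Fin N} (hij : i ≠ j) (a b c d : VF (FF N m)) :
    Alt (quad (vmap (permAut N m (Equiv.swap i j)) a) (vmap (permAut N m (Equiv.swap i j)) b)
      (vmap (permAut N m (Equiv.swap i j)) c) (vmap (permAut N m (Equiv.swap i j)) d)) =
      -Alt (quad a b c d) := by
  rw [Alt_quad_perm, Equiv.Perm.sign_swap hij]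
  simp

theorem eq_zero_of_eq_neg {n : ℕ} {x : TP (FF N m) n} (h : x = -x) : x = 0 := by
  have h2 : (2 : ℚ) • x = 0 := by
    rw [two_smul]
    nth_rewrite 1 [h]
    exact neg_add_cancel x
  exact (smul_eq_zero.mp h2).resolve_left two_ne_zero

theorem Pit_Alt_quad (a b c d : VF (FF N m)) :
    Pit 4 (Alt (quad a b c d)) = Alt (Pit 4 (quad a b c d)) := by
  rw [Alt, Alt, map_sum]
  refine Finset.sum_congr rfl fun σ _ => ?_
  rw [map_smul, tpMap_quad, Pit_quad, Pit_quad]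
  simp only [map_sub, tpMap_quad]

end Skew

/-! ### Brackets -/

section Bracket

variable {N m : ℕ}

theorem permAut_dets (σ : Equiv.Perm (Fin N)) (c : Fin m → Fin N) :
    permAut N m σ (dets N m c) = dets N m (fun i => σ (c i)) := by
  rw [dets, RingEquiv.map_det, dets]
  congr 1
  ext r k
  simp [gen, permAut, MvPolynomial.rename_X]

theorem cls_dets_perm (π : Equiv.Perm (Fin m)) (c : Fin m → Fin N) :
    cls (dets N m (fun i => c (π i))) = cls (dets N m c) := by
  have h : dets N m (fun i => c (π i)) =
      ((Equiv.Perm.sign π : ℤˣ) : ℤ) * dets N m c := by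
    rw [dets, dets, ← Matrix.det_permute']
    rfl
  rw [h]
  rcases Int.units_eq_one_or (Equiv.Perm.sign π) with h | h <;> simp [h, cls_neg]

/-- The determinant of the generic matrix with the selected columns, as a polynomial. -/
def detsPol (N m : ℕ) (c : Fin m → Fin N) : Pol N m :=
  (Matrix.of fun r k => (MvPolynomial.X (c k, r) : Pol N m)).det

theorem dets_eq_algebraMap (c : Fin m → Fin N) :
    dets N m c = algebraMap (Pol N m) (FF N m) (detsPol N m c) := by
  rw [detsPol, RingHom.map_det]
  rfl

theorem eval_detsPol (v : Fin N × Fin m → ℚ) (c : Fin m → Fin N) :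
    MvPolynomial.eval v (detsPol N m c) = (Matrix.of fun r k => v (c k, r)).det := by
  rw [detsPol, RingHom.map_det]
  congr 1
  ext r k
  simp

theorem dets_ne_zero {c : Fin m → Fin N} (hc : Function.Injective c) : dets N m c ≠ 0 := by
  rw [dets_eq_algebraMap]
  intro h
  have h0 := (IsFractionRing.injective (Pol N m) (FF N m)) (h.trans (map_zero _).symm)
  have h1 := eval_detsPol (fun p => if p.1 = c p.2 then 1 else 0) c
  have h2 : (Matrix.of fun r k => if c k = c r then (1 : ℚ) else 0) = 1 := by
    ext r k
    simp [Matrix.one_apply, hc.eq_iff, eq_comm]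
  rw [h0, map_zero] at h1
  simp only [h2, Matrix.det_one] at h1
  exact zero_ne_one h1

/-- The class of the bracket on a set of vectors (zero unless the set has `m` elements). -/
def br (m : ℕ) (s : Set (Fin N)) : VF (FF N m) :=
  if h : ∃ c : Fin m → Fin N, Function.Injective c ∧ Set.range c = s then cls (dets N m h.choose)
  else 0

theorem br_range {c : Fin m → Fin N} (hc : Function.Injective c) :
    br m (Set.range c) = cls (dets N m c) := by
  have h : ∃ c' : Fin m → Fin N, Function.Injective c' ∧ Set.range c' = Set.range c := ⟨c, hc, rfl⟩
  rw [br, dif_pos h]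
  obtain ⟨hinj, hran⟩ := h.choose_spec
  set c' := h.choose
  let π : Equiv.Perm (Fin m) :=
    (Equiv.ofInjective c' hinj).trans ((Equiv.setCongr hran).trans (Equiv.ofInjective c hc).symm)
  have hπ : (fun i => c (π i)) = c' := by
    ext1 i
    exact congrArg Subtype.val
      ((Equiv.ofInjective c hc).apply_symm_apply ⟨c' i, hran ▸ Set.mem_range_self i⟩)
  rw [← cls_dets_perm π c, hπ]

theorem vmap_br (σ : Equiv.Perm (Fin N)) (s : Set (Fin N)) :
    vmap (permAut N m σ) (br m s) = br m (σ.symm ⁻¹' s) := by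
  by_cases h : ∃ c : Fin m → Fin N, Function.Injective c ∧ Set.range c = s
  · obtain ⟨c, hc, rfl⟩ := h
    have hr : σ.symm ⁻¹' Set.range c = Set.range fun i => σ (c i) := by
      rw [← Equiv.image_eq_preimage_symm, ← Set.range_comp]
      rfl
    rw [br_range hc, vmap_cls, permAut_dets, hr]
    exact (br_range (σ.injective.comp hc)).symm
  · have h' : ¬ ∃ c : Fin m → Fin N, Function.Injective c ∧ Set.range c = σ.symm ⁻¹' s := by
      rintro ⟨c, hc, hr⟩
      refine h ⟨fun i => σ.symm (c i), σ.symm.injective.comp hc, ?_⟩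
      rw [Set.range_comp', hr, Set.image_preimage_eq _ σ.symm.surjective]
    rw [br, br, dif_neg h, dif_neg h', map_zero]

end Bracket

end

end GrassPoly
namespace GrassPoly

/-! ### Formal combinations of words

A tensor of four subsets of `{1, …, 8}` is recorded by the list of the eight binary words that tell,
for each point, which of the four subsets contain it. Skew-symmetrization is alternating in this
list, so sorting brings it to a normal form. -/

section Words

/-- Membership of a label in a list of labels. -/
def hasLabel (i : ℕ) : List ℕ → Bool
  | [] => false
  | a :: l => Nat.beq i a || hasLabel i l

/-- The binary word of a point, from its membership in four subsets. -/
def bitWord (a b c d : Bool) : ℕ :=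
  cond a 1 0 + (cond b 2 0 + (cond c 4 0 + cond d 8 0))

/-- The words of the eight points for four subsets given as lists of labels. -/
def pointWords (s t u v : List ℕ) : List ℕ :=
  [1, 2, 3, 4, 5, 6, 7, 8].map fun i =>
    bitWord (hasLabel i s) (hasLabel i t) (hasLabel i u) (hasLabel i v)

/-- Signed insertion into a sorted list, with sign zero when a repetition is met. -/
def signedInsert (a : ℕ) : List ℕ → ℤ × List ℕ
  | [] => (1, [a])
  | b :: l =>
    cond (Nat.ble a b) (cond (Nat.ble b a) (0, []) (1, a :: b :: l))
      (-(signedInsert a l).1, b :: (signedInsert a l).2)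

/-- Signed insertion sort, with sign zero when there is a repetition. -/
def signedSort : List ℕ → ℤ × List ℕ
  | [] => (1, [])
  | a :: l =>
    ((signedSort l).1 * (signedInsert a (signedSort l).2).1, (signedInsert a (signedSort l).2).2)

/-- Equality test for lists of natural numbers. -/
def eqList : List ℕ → List ℕ → Bool
  | [], [] => true
  | a :: l, b :: l' => Nat.beq a b && eqList l l'
  | _, _ => false

theorem eq_of_eqList : ∀ {l l' : List ℕ}, eqList l l' = true → l = l'
  | [], [], _ => rfl
  | [], _ :: _, h => by simp [eqList] at h
  | _ :: _, [], h => by simp [eqList] at h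
  | a :: l, b :: l', h => by
    simp only [eqList, Bool.and_eq_true] at h
    rw [Nat.eq_of_beq_eq_true h.1, eq_of_eqList h.2]

/-- Add a term to a formal combination, merging it with an equal word. -/
def addTerm (c : ℤ) (k : List ℕ) : List (ℤ × List ℕ) → List (ℤ × List ℕ)
  | [] => [(c, k)]
  | p :: L => cond (eqList k p.2) ((c + p.1, p.2) :: L) (p :: addTerm c k L)

/-- Test for zero. -/
def isZero (c : ℤ) : Bool := Nat.beq c.natAbs 0

theorem eq_zero_of_isZero {c : ℤ} (h : isZero c = true) : c = 0 :=
  Int.natAbs_eq_zero.mp (Nat.eq_of_beq_eq_true h)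

/-- Sort all words of a formal combination and collect equal ones. -/
def collect : List (ℤ × List ℕ) → List (ℤ × List ℕ)
  | [] => []
  | p :: L =>
    cond (isZero (signedSort p.2).1) (collect L)
      (addTerm (p.1 * (signedSort p.2).1) (signedSort p.2).2 (collect L))

/-- All coefficients of a formal combination vanish. -/
def allZero : List (ℤ × List ℕ) → Bool
  | [] => true
  | p :: L => isZero p.1 && allZero L

/-- The tensor product of four formal combinations of subsets, as a combination of words. -/
def tensorWords (X Y Z T : List (ℤ × List ℕ)) : List (ℤ × List ℕ) :=
  X.flatMap fun x => Y.flatMap fun y => Z.flatMap fun z => T.map fun t =>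
    (x.1 * (y.1 * (z.1 * t.1)), pointWords x.2 y.2 z.2 t.2)

/-- Difference of formal combinations. -/
def subWords (L L' : List (ℤ × List ℕ)) : List (ℤ × List ℕ) :=
  L ++ L'.map fun p => (-p.1, p.2)

/-- The labels `i`, `j` lie in the same ones of the given subsets. -/
def sameSide (i j : ℕ) : List (List ℕ) → Bool
  | [] => true
  | s :: L => !(Bool.xor (hasLabel i s) (hasLabel j s)) && sameSide i j L

end Words

noncomputable section

section Combination

variable {W : Type*} [AddCommGroup W] [Module ℚ W] (f : List ℕ → W)

/-- The value of a formal combination under an assignment of values to lists. -/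
def comb (L : List (ℤ × List ℕ)) : W := (L.map fun p => (p.1 : ℚ) • f p.2).sum

theorem comb_nil : comb f [] = 0 := rfl

theorem comb_cons (p : ℤ × List ℕ) (L : List (ℤ × List ℕ)) :
    comb f (p :: L) = (p.1 : ℚ) • f p.2 + comb f L := by
  simp [comb]

theorem comb_append (L L' : List (ℤ × List ℕ)) :
    comb f (L ++ L') = comb f L + comb f L' := by
  simp [comb]

theorem comb_addTerm (c : ℤ) (k : List ℕ) (L : List (ℤ × List ℕ)) :
    comb f (addTerm c k L) = (c : ℚ) • f k + comb f L := by
  induction L with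
  | nil => simp [addTerm, comb]
  | cons p L ih =>
    rw [addTerm]
    rcases h : eqList k p.2 with _ | _
    · rw [cond_false, comb_cons, comb_cons, ih]
      abel
    · rw [cond_true, comb_cons, comb_cons, eq_of_eqList h]
      simp only [Int.cast_add, add_smul]
      abel

theorem comb_collect (L : List (ℤ × List ℕ))
    (h : ∀ p ∈ L, f p.2 = ((signedSort p.2).1 : ℚ) • f (signedSort p.2).2) :
    comb f (collect L) = comb f L := by
  induction L with
  | nil => rfl
  | cons p L ih =>
    have ih := ih fun q hq => h q (List.mem_cons_of_mem _ hq)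
    rw [comb_cons, h p List.mem_cons_self, collect]
    rcases h0 : isZero (signedSort p.2).1 with _ | _
    · rw [cond_false, comb_addTerm, ih, smul_smul, Int.cast_mul]
    · rw [cond_true, ih, eq_zero_of_isZero h0]
      simp

theorem comb_eq_zero_of_allZero {L : List (ℤ × List ℕ)} (h : allZero L = true) :
    comb f L = 0 := by
  induction L with
  | nil => rfl
  | cons p L ih =>
    rw [allZero, Bool.and_eq_true] at h
    rw [comb_cons, ih h.2, eq_zero_of_isZero h.1]
    simp

theorem comb_subWords (L L' : List (ℤ × List ℕ)) :
    comb f (subWords L L') = comb f L - comb f L' := by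
  rw [subWords, comb_append, sub_eq_add_neg]
  congr 1
  induction L' with
  | nil => simp [comb]
  | cons p L' ih => simp [comb_cons, ih, add_comm]

theorem comb_flatMap {ι : Type*} (X : List ι) (g : ι → List (ℤ × List ℕ)) :
    comb f (X.flatMap g) = (X.map fun x => comb f (g x)).sum := by
  induction X with
  | nil => rfl
  | cons x X ih => rw [List.flatMap_cons, comb_append, List.map_cons, List.sum_cons, ih]

theorem map_comb {W' : Type*} [AddCommGroup W'] [Module ℚ W'] (g : W →ₗ[ℚ] W')
    (L : List (ℤ × List ℕ)) : g (comb f L) = comb (fun l => g (f l)) L := by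
  induction L with
  | nil => simp [comb]
  | cons p L ih => simp [comb_cons, ih]

theorem comb_comb_comb_comb (g : List ℕ → List ℕ → List ℕ → List ℕ → List ℕ)
    (X Y Z T : List (ℤ × List ℕ)) :
    comb f (X.flatMap fun x => Y.flatMap fun y => Z.flatMap fun z => T.map fun t =>
      (x.1 * (y.1 * (z.1 * t.1)), g x.2 y.2 z.2 t.2)) =
    comb (fun x => comb (fun y => comb (fun z => comb (fun t => f (g x y z t)) T) Z) Y) X := by
  have h : ∀ {ι : Type} (c : ℚ) (L : List ι) (u : ι → W),
      c • (L.map u).sum = (L.map fun x => c • u x).sum := by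
    intro ι c L u
    induction L with
    | nil => simp
    | cons x L ih => simp [ih]
  simp only [comb_flatMap]
  simp only [comb, List.map_map, Function.comp_def, h, smul_smul, Int.cast_mul]

theorem comb_eq_zero {L : List (ℤ × List ℕ)} (h : ∀ p ∈ L, f p.2 = 0) : comb f L = 0 := by
  refine List.sum_eq_zero fun x hx => ?_
  obtain ⟨p, hp, rfl⟩ := List.mem_map.mp hx
  rw [h p hp, smul_zero]

end Combination

/-- The class of the bracket on a set of labels in `{1, …, 8}`. -/
def brL (s : List ℕ) : VF K4 := br 4 {i : Fin 8 | hasLabel (i + 1) s = true}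

/-- The class of the bracket on the points whose word has a given bit. -/
def wordLetter (l : List ℕ) (k : ℕ) : VF K4 :=
  br 4 {i : Fin 8 | (l.getD i 0).testBit k = true}

/-- The skew-symmetrized tensor given by a list of words. -/
def altWord (l : List ℕ) : TP K4 4 :=
  Alt (quad (wordLetter l 0) (wordLetter l 1) (wordLetter l 2) (wordLetter l 3))

theorem altWord_swap (p l : List ℕ) (a b : ℕ) (h : p.length + 2 ≤ 8) :
    altWord (p ++ a :: b :: l) = -altWord (p ++ b :: a :: l) := by
  let i : Fin 8 := ⟨p.length, by omega⟩
  let j : Fin 8 := ⟨p.length + 1, by omega⟩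
  have hij : i ≠ j := by simp [i, j]
  have key : ∀ k, wordLetter (p ++ a :: b :: l) k =
      vmap (permAut 8 4 (Equiv.swap i j)) (wordLetter (p ++ b :: a :: l) k) := by
    intro k
    rw [wordLetter, wordLetter, vmap_br]
    congr 1
    ext x
    have hx : (p ++ a :: b :: l).getD x 0 = (p ++ b :: a :: l).getD (Equiv.swap i j x) 0 := by
      by_cases h1 : x = i
      · subst h1
        simp [i, j]
      by_cases h2 : x = j
      · subst h2
        simp [i, j]
      rw [Equiv.swap_apply_of_ne_of_ne h1 h2]
      have h1' : (x : ℕ) ≠ p.length := fun e => h1 (Fin.ext e)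
      have h2' : (x : ℕ) ≠ p.length + 1 := fun e => h2 (Fin.ext e)
      rcases lt_or_ge (x : ℕ) p.length with h3 | h3
      · rw [List.getD_append _ _ _ _ h3, List.getD_append _ _ _ _ h3]
      · rw [List.getD_append_right _ _ _ _ h3, List.getD_append_right _ _ _ _ h3]
        obtain ⟨n, hn⟩ : ∃ n, (x : ℕ) - p.length = n + 2 := ⟨x - p.length - 2, by omega⟩
        simp [hn]
    simp only [Set.mem_ofPred_eq, Set.mem_preimage, Equiv.symm_swap, hx]
  rw [altWord, key, key, key, key, Alt_quad_swap hij, altWord]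

theorem altWord_signedInsert (a : ℕ) (l p : List ℕ) (h : p.length + l.length + 1 ≤ 8) :
    altWord (p ++ a :: l) =
      ((signedInsert a l).1 : ℚ) • altWord (p ++ (signedInsert a l).2) := by
  induction l generalizing p with
  | nil => simp [signedInsert]
  | cons b l ih =>
    simp only [List.length_cons] at h
    rw [signedInsert]
    rcases h1 : Nat.ble a b with _ | _
    · have := ih (p ++ [b]) (by simp; omega)
      simp only [List.append_assoc, List.singleton_append] at this
      rw [altWord_swap p l a b (by omega), this]
      simp
    · rcases h2 : Nat.ble b a with _ | _
      · simp
      · obtain rfl := le_antisymm (Nat.le_of_ble_eq_true h1) (Nat.le_of_ble_eq_true h2)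
        simpa using eq_zero_of_eq_neg (altWord_swap p l a a (by omega))

theorem length_signedInsert_le (a : ℕ) (l : List ℕ) :
    (signedInsert a l).2.length ≤ l.length + 1 := by
  induction l with
  | nil => simp [signedInsert]
  | cons b l ih =>
    rw [signedInsert]
    rcases Nat.ble a b with _ | _
    · simpa using ih
    · rcases Nat.ble b a with _ | _ <;> simp

theorem length_signedSort_le (l : List ℕ) : (signedSort l).2.length ≤ l.length := by
  induction l with
  | nil => simp [signedSort]
  | cons a l ih => exact (length_signedInsert_le _ _).trans (by simpa using ih)

theorem altWord_append_signedSort (l p : List ℕ) (h : p.length + l.length ≤ 8) :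
    altWord (p ++ l) = ((signedSort l).1 : ℚ) • altWord (p ++ (signedSort l).2) := by
  induction l generalizing p with
  | nil => simp [signedSort]
  | cons a l ih =>
    simp only [List.length_cons] at h
    have h1 := ih (p ++ [a]) (by simp; omega)
    simp only [List.append_assoc, List.singleton_append] at h1
    have h2 := length_signedSort_le l
    rw [h1, altWord_signedInsert a _ p (by omega), smul_smul, signedSort, Int.cast_mul]

theorem altWord_signedSort {l : List ℕ} (h : l.length ≤ 8) :
    altWord l = ((signedSort l).1 : ℚ) • altWord (signedSort l).2 :=
  altWord_append_signedSort l [] (by simpa using h)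

theorem altWord_pointWords (s t u v : List ℕ) :
    altWord (pointWords s t u v) = Alt (quad (brL s) (brL t) (brL u) (brL v)) := by
  have hword : ∀ i : Fin 8, (pointWords s t u v).getD i 0 =
      bitWord (hasLabel (i + 1) s) (hasLabel (i + 1) t) (hasLabel (i + 1) u)
        (hasLabel (i + 1) v) := by
    intro i
    fin_cases i <;> rfl
  have hbit : ∀ a b c d : Bool, (bitWord a b c d).testBit 0 = a ∧
      (bitWord a b c d).testBit 1 = b ∧ (bitWord a b c d).testBit 2 = c ∧
      (bitWord a b c d).testBit 3 = d := by
    rintro (_ | _) (_ | _) (_ | _) (_ | _) <;> exact ⟨rfl, rfl, rfl, rfl⟩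
  simp only [altWord, wordLetter, brL, hword, hbit]

theorem Alt_quad_comb_fst (X : List (ℤ × List ℕ)) (b c d : VF K4) :
    Alt (quad (comb brL X) b c d) = comb (fun x => Alt (quad (brL x) b c d)) X := by
  have := map_comb brL (altLin 8 4 4 ∘ₗ quadFst b c d) X
  simpa only [LinearMap.comp_apply, altLin_apply, quadFst_apply] using this

theorem Alt_quad_comb_snd (X : List (ℤ × List ℕ)) (a c d : VF K4) :
    Alt (quad a (comb brL X) c d) = comb (fun x => Alt (quad a (brL x) c d)) X := by
  have := map_comb brL (altLin 8 4 4 ∘ₗ quadSnd a c d) X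
  simpa only [LinearMap.comp_apply, altLin_apply, quadSnd_apply] using this

theorem Alt_quad_comb_trd (X : List (ℤ × List ℕ)) (a b d : VF K4) :
    Alt (quad a b (comb brL X) d) = comb (fun x => Alt (quad a b (brL x) d)) X := by
  have := map_comb brL (altLin 8 4 4 ∘ₗ quadTrd a b d) X
  simpa only [LinearMap.comp_apply, altLin_apply, quadTrd_apply] using this

theorem Alt_quad_comb_fth (X : List (ℤ × List ℕ)) (a b c : VF K4) :
    Alt (quad a b c (comb brL X)) = comb (fun x => Alt (quad a b c (brL x))) X := by
  have := map_comb brL (altLin 8 4 4 ∘ₗ quadFth a b c) X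
  simpa only [LinearMap.comp_apply, altLin_apply, quadFth_apply] using this

theorem comb_tensorWords (X Y Z T : List (ℤ × List ℕ)) :
    comb altWord (tensorWords X Y Z T) =
      Alt (quad (comb brL X) (comb brL Y) (comb brL Z) (comb brL T)) := by
  rw [tensorWords, comb_comb_comb_comb, Alt_quad_comb_fst]
  simp only [Alt_quad_comb_snd]
  simp only [Alt_quad_comb_trd]
  simp only [Alt_quad_comb_fth, altWord_pointWords]

theorem length_of_mem_tensorWords {X Y Z T : List (ℤ × List ℕ)} {p : ℤ × List ℕ}
    (h : p ∈ tensorWords X Y Z T) : p.2.length ≤ 8 := by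
  simp only [tensorWords, List.mem_flatMap, List.mem_map] at h
  obtain ⟨x, -, y, -, z, -, t, -, rfl⟩ := h
  simp [pointWords]

theorem vmap_swap_brL {i j : Fin 8} {s : List ℕ}
    (h : hasLabel (i + 1) s = hasLabel (j + 1) s) :
    vmap (permAut 8 4 (Equiv.swap i j)) (brL s) = brL s := by
  rw [brL, vmap_br]
  congr 1
  ext x
  simp only [Equiv.symm_swap, Set.mem_preimage, Set.mem_ofPred_eq]
  by_cases h1 : x = i
  · subst h1
    rw [Equiv.swap_apply_left, h]
  by_cases h2 : x = j
  · subst h2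
    rw [Equiv.swap_apply_right, h]
  rw [Equiv.swap_apply_of_ne_of_ne h1 h2]

end

end GrassPoly
namespace GrassPoly

/-! ### Brackets of labels and the `ρ`-functions -/

section Certificate

/-- One of the transpositions `(2 3)`, `(5 6)`, `(7 8)` preserves the given subsets. -/
def swappable (L : List (List ℕ)) : Bool :=
  sameSide 2 3 L || (sameSide 5 6 L || sameSide 7 8 L)

/-- The brackets of `ρ_{2,4}/ρ_{3,4}` other than the quadratic factor. -/
def crossBrackets : List (ℤ × List ℕ) :=
  [(-1, [2, 3, 4, 8]), (1, [3, 4, 5, 8]), (-1, [3, 4, 5, 6]), (-1, [4, 5, 7, 8])]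

/-- The brackets of `1 - ρ_{2,4}/ρ_{3,4}`. -/
def oneSubCrossBrackets : List (ℤ × List ℕ) :=
  [(1, [2, 3, 4, 5]), (1, [3, 4, 7, 8]), (-1, [2, 3, 4, 8]), (-1, [3, 4, 5, 6]),
    (-1, [4, 5, 7, 8]), (1, [4, 5, 6, 8])]

/-- The brackets of `ρ_{1,2}`. -/
def diffBrackets : List (ℤ × List ℕ) :=
  [(1, [1, 2, 3, 4]), (1, [2, 3, 7, 8]), (-1, [1, 2, 3, 8]), (-1, [2, 3, 4, 8])]

/-- The brackets of `ρ_1/ρ_4`. -/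
def ratioBrackets : List (ℤ × List ℕ) :=
  [(1, [1, 2, 3, 7]), (-1, [1, 2, 3, 8]), (-1, [4, 5, 6, 7]), (1, [4, 5, 6, 8])]

/-- The words of `7 Π̃₄(a ⊗ b ⊗ c ⊗ d)`. -/
def projectedWords (a b c d : List ℕ) : List (ℤ × List ℕ) :=
  [(7, pointWords a b c d), (-7, pointWords b a c d), (-7, pointWords b c a d),
    (7, pointWords c b a d), (-7, pointWords b c d a), (7, pointWords c b d a),
    (7, pointWords c d b a), (-7, pointWords d c b a)]

/-- The words of the difference of the two sides of the formula. -/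
def differenceWords : List (ℤ × List ℕ) :=
  subWords (projectedWords [1, 2, 3, 4] [2, 3, 4, 5] [3, 4, 5, 6] [4, 5, 6, 7])
    (subWords (tensorWords crossBrackets oneSubCrossBrackets diffBrackets ratioBrackets)
      (tensorWords oneSubCrossBrackets crossBrackets diffBrackets ratioBrackets))

local instance decidableEqBool (a b : Bool) : Decidable (a = b) :=
  instDecidableEqBool a b

theorem allZero_differenceWords : allZero (collect differenceWords) = true := by
  decide +kernel

theorem all_swappable :
    (oneSubCrossBrackets.all fun x => diffBrackets.all fun y => ratioBrackets.all fun z =>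
      swappable [x.2, y.2, z.2]) = true := by
  decide +kernel

end Certificate

noncomputable section

theorem cls_d4 {a b c d : ℕ} (hab : a ≠ b) (hac : a ≠ c) (had : a ≠ d) (hbc : b ≠ c) (hbd : b ≠ d)
    (hcd : c ≠ d) (ha : 1 ≤ a ∧ a ≤ 8) (hb : 1 ≤ b ∧ b ≤ 8) (hc : 1 ≤ c ∧ c ≤ 8)
    (hd : 1 ≤ d ∧ d ≤ 8) :
    d4 a b c d ≠ 0 ∧ cls (d4 a b c d) = brL [a, b, c, d] := by
  have hL : ∀ {x y : ℕ}, 1 ≤ x ∧ x ≤ 8 → 1 ≤ y ∧ y ≤ 8 → x ≠ y → L8 x ≠ L8 y := by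
    intro x y hx hy hxy h
    have := congrArg Fin.val h
    simp only [L8] at this
    omega
  have hinj : Function.Injective ![L8 a, L8 b, L8 c, L8 d] := by
    intro i j hij
    fin_cases i <;> fin_cases j <;> first | rfl | (exfalso; revert hij; simp [*, Ne.symm])
  refine ⟨dets_ne_zero hinj, ?_⟩
  rw [d4, ← br_range hinj, brL]
  congr 1
  ext i
  have hi := i.isLt
  simp only [Set.mem_range, Fin.exists_fin_succ, Set.mem_ofPred_eq, hasLabel, L8, Fin.ext_iff]
  simp
  omega

theorem cls_d4_of_lt {a b c d : ℕ} (h : a < b ∧ b < c ∧ c < d ∧ 1 ≤ a ∧ d ≤ 8) :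
    d4 a b c d ≠ 0 ∧ cls (d4 a b c d) = brL [a, b, c, d] :=
  cls_d4 (by omega) (by omega) (by omega) (by omega) (by omega) (by omega) (by omega) (by omega)
    (by omega) (by omega)

/-- The determinant of four column vectors. -/
def colDet {R : Type*} [CommRing R] (x y z w : Fin 4 → R) : R :=
  (Matrix.of fun r c => (![x, y, z, w] : Fin 4 → Fin 4 → R) c r).det

theorem colDet_eq {R : Type*} [CommRing R] (x y z w : Fin 4 → R) :
    colDet x y z w =
      (x 0 * y 1 - x 1 * y 0) * (z 2 * w 3 - z 3 * w 2) -
      (x 0 * y 2 - x 2 * y 0) * (z 1 * w 3 - z 3 * w 1) +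
      (x 0 * y 3 - x 3 * y 0) * (z 1 * w 2 - z 2 * w 1) +
      (x 1 * y 2 - x 2 * y 1) * (z 0 * w 3 - z 3 * w 0) -
      (x 1 * y 3 - x 3 * y 1) * (z 0 * w 2 - z 2 * w 0) +
      (x 2 * y 3 - x 3 * y 2) * (z 0 * w 1 - z 1 * w 0) := by
  simp [colDet, Matrix.det_succ_row_zero, Fin.sum_univ_succ, Fin.succAbove]
  ring

theorem colDet_plucker {R : Type*} [CommRing R] (a b c d e f : Fin 4 → R) :
    colDet a b c e * colDet b c d f - colDet b c d e * colDet a b c f =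
      colDet a b c d * colDet b c e f := by
  simp only [colDet_eq]
  ring

theorem d4_eq_colDet (a b c d : ℕ) :
    d4 a b c d = colDet (gen 8 4 (L8 a)) (gen 8 4 (L8 b)) (gen 8 4 (L8 c)) (gen 8 4 (L8 d)) := by
  rw [d4, dets, colDet]
  congr 1
  ext r k
  fin_cases k <;> rfl

theorem d4_plucker (a b c d e f : ℕ) :
    d4 a b c e * d4 b c d f - d4 b c d e * d4 a b c f = d4 a b c d * d4 b c e f := by
  simp only [d4_eq_colDet, colDet_plucker]

theorem d4_swap_fst (a b c d : ℕ) : d4 b a c d = -d4 a b c d := by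
  simp only [d4_eq_colDet, colDet_eq]
  ring

theorem d4_swap_mid (a b c d : ℕ) : d4 a c b d = -d4 a b c d := by
  simp only [d4_eq_colDet, colDet_eq]
  ring

/-- The numerator of `ρ_{2,4}`. -/
def quadric : K4 := d4 2 3 4 7 * d4 4 5 6 8 - d4 4 5 6 7 * d4 2 3 4 8

theorem quadric_ne_zero : quadric ≠ 0 := by
  intro h
  let P : Pol 8 4 :=
    detsPol 8 4 ![L8 2, L8 3, L8 4, L8 7] * detsPol 8 4 ![L8 4, L8 5, L8 6, L8 8] -
      detsPol 8 4 ![L8 4, L8 5, L8 6, L8 7] * detsPol 8 4 ![L8 2, L8 3, L8 4, L8 8]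
  have hP : algebraMap (Pol 8 4) (FF 8 4) P = 0 := by
    rw [← h, quadric, map_sub, map_mul, map_mul]
    simp only [d4, dets_eq_algebraMap]
  have hP0 : P = 0 := IsFractionRing.injective (Pol 8 4) (FF 8 4) (hP.trans (map_zero _).symm)
  let e : Fin 8 → Fin 4 := ![0, 0, 1, 2, 1, 3, 3, 0]
  have h1 := congrArg (MvPolynomial.eval fun p => if e p.1 = p.2 then (1 : ℚ) else 0) hP0
  simp only [P, map_sub, map_mul, eval_detsPol, map_zero] at h1
  simp [Matrix.det_succ_row_zero, Fin.sum_univ_succ, Fin.succAbove, e, L8] at h1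

theorem permAut_d4 (σ : Equiv.Perm (Fin 8)) {a b c d a' b' c' d' : ℕ} (ha : σ (L8 a) = L8 a')
    (hb : σ (L8 b) = L8 b') (hc : σ (L8 c) = L8 c') (hd : σ (L8 d) = L8 d') :
    permAut 8 4 σ (d4 a b c d) = d4 a' b' c' d' := by
  rw [d4, permAut_dets, d4]
  congr 1
  ext1 i
  fin_cases i <;> assumption

theorem vmap_swap_quadric {i j : ℕ} (h : (i, j) = (2, 3) ∨ (i, j) = (5, 6) ∨ (i, j) = (7, 8)) :
    vmap (permAut 8 4 (Equiv.swap (L8 i) (L8 j))) (cls quadric) = cls quadric := by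
  rw [vmap_cls, ← cls_neg quadric]
  congr 1
  simp only [Prod.mk.injEq] at h
  rcases h with ⟨rfl, rfl⟩ | ⟨rfl, rfl⟩ | ⟨rfl, rfl⟩
  · rw [quadric, map_sub, map_mul, map_mul,
      permAut_d4 (a := 2) (b := 3) (c := 4) (d := 7) (a' := 3) (b' := 2) (c' := 4) (d' := 7),
      permAut_d4 (a := 4) (b := 5) (c := 6) (d := 8) (a' := 4) (b' := 5) (c' := 6) (d' := 8),
      permAut_d4 (a := 4) (b := 5) (c := 6) (d := 7) (a' := 4) (b' := 5) (c' := 6) (d' := 7),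
      permAut_d4 (a := 2) (b := 3) (c := 4) (d := 8) (a' := 3) (b' := 2) (c' := 4) (d' := 8),
      d4_swap_fst 2 3 4 7, d4_swap_fst 2 3 4 8]
    · ring
    all_goals simp [Equiv.swap_apply_def, L8]
  · rw [quadric, map_sub, map_mul, map_mul,
      permAut_d4 (a := 2) (b := 3) (c := 4) (d := 7) (a' := 2) (b' := 3) (c' := 4) (d' := 7),
      permAut_d4 (a := 4) (b := 5) (c := 6) (d := 8) (a' := 4) (b' := 6) (c' := 5) (d' := 8),
      permAut_d4 (a := 4) (b := 5) (c := 6) (d := 7) (a' := 4) (b' := 6) (c' := 5) (d' := 7),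
      permAut_d4 (a := 2) (b := 3) (c := 4) (d := 8) (a' := 2) (b' := 3) (c' := 4) (d' := 8),
      d4_swap_mid 4 5 6 8, d4_swap_mid 4 5 6 7]
    · ring
    all_goals simp [Equiv.swap_apply_def, L8]
  · rw [quadric, map_sub, map_mul, map_mul,
      permAut_d4 (a := 2) (b := 3) (c := 4) (d := 7) (a' := 2) (b' := 3) (c' := 4) (d' := 8),
      permAut_d4 (a := 4) (b := 5) (c := 6) (d := 8) (a' := 4) (b' := 5) (c' := 6) (d' := 7),
      permAut_d4 (a := 4) (b := 5) (c := 6) (d := 7) (a' := 4) (b' := 5) (c' := 6) (d' := 8),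
      permAut_d4 (a := 2) (b := 3) (c := 4) (d := 8) (a' := 2) (b' := 3) (c' := 4) (d' := 7)]
    · ring
    all_goals simp [Equiv.swap_apply_def, L8]

theorem vmap_swap_quadric_and_brL {i j : ℕ} {L : List (List ℕ)}
    (h : (i, j) = (2, 3) ∨ (i, j) = (5, 6) ∨ (i, j) = (7, 8)) (hL : sameSide i j L = true) :
    L8 i ≠ L8 j ∧
    vmap (permAut 8 4 (Equiv.swap (L8 i) (L8 j))) (cls quadric) = cls quadric ∧
    ∀ s ∈ L, vmap (permAut 8 4 (Equiv.swap (L8 i) (L8 j))) (brL s) = brL s := by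
  have hij : L8 i ≠ L8 j ∧ (L8 i : ℕ) + 1 = i ∧ (L8 j : ℕ) + 1 = j := by
    simp only [Prod.mk.injEq] at h
    rcases h with ⟨rfl, rfl⟩ | ⟨rfl, rfl⟩ | ⟨rfl, rfl⟩ <;> simp [L8]
  refine ⟨hij.1, vmap_swap_quadric h, fun s hs => vmap_swap_brL ?_⟩
  rw [hij.2.1, hij.2.2]
  clear h
  induction L with
  | nil => simp at hs
  | cons t L ih =>
    rw [sameSide, Bool.and_eq_true] at hL
    rcases List.mem_cons.mp hs with rfl | hs
    · simpa using hL.1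
    · exact ih hL.2 hs

theorem exists_swap_of_swappable {L : List (List ℕ)} (h : swappable L = true) :
    ∃ i j : Fin 8, i ≠ j ∧
      vmap (permAut 8 4 (Equiv.swap i j)) (cls quadric) = cls quadric ∧
      ∀ s ∈ L, vmap (permAut 8 4 (Equiv.swap i j)) (brL s) = brL s := by
  simp only [swappable, Bool.or_eq_true] at h
  rcases h with h | h | h
  · exact ⟨_, _, vmap_swap_quadric_and_brL (Or.inl rfl) h⟩
  · exact ⟨_, _, vmap_swap_quadric_and_brL (Or.inr (Or.inl rfl)) h⟩
  · exact ⟨_, _, vmap_swap_quadric_and_brL (Or.inr (Or.inr rfl)) h⟩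

theorem Alt_quad_quadric_eq_zero {x y z : ℤ × List ℕ} (hx : x ∈ oneSubCrossBrackets)
    (hy : y ∈ diffBrackets) (hz : z ∈ ratioBrackets) :
    Alt (quad (cls quadric) (brL x.2) (brL y.2) (brL z.2)) = 0 ∧
      Alt (quad (brL x.2) (cls quadric) (brL y.2) (brL z.2)) = 0 := by
  have h := all_swappable
  simp only [List.all_eq_true] at h
  obtain ⟨i, j, hij, hq, hs⟩ := exists_swap_of_swappable (h x hx y hy z hz)
  have h1 := Alt_quad_swap hij (cls quadric) (brL x.2) (brL y.2) (brL z.2)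
  have h2 := Alt_quad_swap hij (brL x.2) (cls quadric) (brL y.2) (brL z.2)
  rw [hq, hs x.2 (by simp), hs y.2 (by simp), hs z.2 (by simp)] at h1 h2
  exact ⟨eq_zero_of_eq_neg h1, eq_zero_of_eq_neg h2⟩

theorem rr_two_four : rr 2 4 = quadric / (d4 2 3 4 8 * d4 4 5 6 8) := by
  have h1 : d4 2 3 4 8 ≠ 0 := (cls_d4_of_lt (by simp)).1
  have h2 : d4 4 5 6 8 ≠ 0 := (cls_d4_of_lt (by simp)).1
  have hr : rr 2 4 = d4 2 3 4 7 / d4 2 3 4 8 - d4 4 5 6 7 / d4 4 5 6 8 := rfl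
  rw [hr, div_sub_div _ _ h1 h2, quadric]
  ring

theorem rr_succ {i : ℕ} (hi : 1 ≤ i ∧ i ≤ 3) :
    rr i (i + 1) = d4 i (i + 1) (i + 2) (i + 3) * d4 (i + 1) (i + 2) 7 8 /
      (d4 i (i + 1) (i + 2) 8 * d4 (i + 1) (i + 2) (i + 3) 8) := by
  have h1 : d4 i (i + 1) (i + 2) 8 ≠ 0 := (cls_d4_of_lt (by omega)).1
  have h2 : d4 (i + 1) (i + 2) (i + 3) 8 ≠ 0 := (cls_d4_of_lt (by omega)).1
  have hM : ∀ j, 1 ≤ j ∧ j ≤ 6 → M6 j = j := by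
    intro j hj
    rw [M6]
    omega
  rw [rr, rho, rho, hM i (by omega), hM (i + 1) (by omega), hM (i + 2) (by omega),
    hM (i + 1 + 2) (by omega), div_sub_div _ _ h1 h2,
    ← d4_plucker i (i + 1) (i + 2) (i + 3) 7 8, mul_comm (d4 (i + 1) (i + 2) (i + 3) 7)]

theorem rr_succ_ne_zero {i : ℕ} (hi : 1 ≤ i ∧ i ≤ 3) : rr i (i + 1) ≠ 0 := by
  rw [rr_succ hi]
  refine div_ne_zero (mul_ne_zero ?_ ?_) (mul_ne_zero ?_ ?_) <;>
  exact (cls_d4_of_lt (by omega)).1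

theorem cls_rr_succ {i : ℕ} (hi : 1 ≤ i ∧ i ≤ 3) :
    cls (rr i (i + 1)) = brL [i, i + 1, i + 2, i + 3] + brL [i + 1, i + 2, 7, 8] -
      (brL [i, i + 1, i + 2, 8] + brL [i + 1, i + 2, i + 3, 8]) := by
  obtain ⟨n1, e1⟩ := cls_d4_of_lt (a := i) (b := i + 1) (c := i + 2) (d := i + 3) (by omega)
  obtain ⟨n2, e2⟩ := cls_d4_of_lt (a := i + 1) (b := i + 2) (c := 7) (d := 8) (by omega)
  obtain ⟨n3, e3⟩ := cls_d4_of_lt (a := i) (b := i + 1) (c := i + 2) (d := 8) (by omega)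
  obtain ⟨n4, e4⟩ := cls_d4_of_lt (a := i + 1) (b := i + 2) (c := i + 3) (d := 8) (by omega)
  rw [rr_succ hi, cls_div (mul_ne_zero n1 n2) (mul_ne_zero n3 n4), cls_mul n1 n2, cls_mul n3 n4,
    e1, e2, e3, e4]

theorem cls_rr_one_two : cls (rr 1 2) = comb brL diffBrackets := by
  rw [cls_rr_succ (by simp)]
  simp [diffBrackets, comb_cons, comb_nil]
  abel

theorem cls_rho_div : cls (rho 1 / rho 4) = comb brL ratioBrackets := by
  obtain ⟨n1, e1⟩ := cls_d4_of_lt (a := 1) (b := 2) (c := 3) (d := 7) (by simp)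
  obtain ⟨n2, e2⟩ := cls_d4_of_lt (a := 1) (b := 2) (c := 3) (d := 8) (by simp)
  obtain ⟨n3, e3⟩ := cls_d4_of_lt (a := 4) (b := 5) (c := 6) (d := 7) (by simp)
  obtain ⟨n4, e4⟩ := cls_d4_of_lt (a := 4) (b := 5) (c := 6) (d := 8) (by simp)
  have h1 : rho 1 = d4 1 2 3 7 / d4 1 2 3 8 := rfl
  have h4 : rho 4 = d4 4 5 6 7 / d4 4 5 6 8 := rfl
  rw [h1, h4, cls_div (div_ne_zero n1 n2) (div_ne_zero n3 n4), cls_div n1 n2, cls_div n3 n4,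
    e1, e2, e3, e4]
  simp [ratioBrackets, comb_cons, comb_nil]
  abel

theorem cls_cross : cls (rr 2 4 / rr 3 4) = cls quadric + comb brL crossBrackets := by
  obtain ⟨n1, e1⟩ := cls_d4_of_lt (a := 2) (b := 3) (c := 4) (d := 8) (by simp)
  obtain ⟨n2, e2⟩ := cls_d4_of_lt (a := 4) (b := 5) (c := 6) (d := 8) (by simp)
  have h24 : rr 2 4 ≠ 0 := rr_two_four ▸ div_ne_zero quadric_ne_zero (mul_ne_zero n1 n2)
  rw [cls_div h24 (rr_succ_ne_zero (i := 3) (by simp)), cls_rr_succ (i := 3) (by simp),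
    rr_two_four, cls_div quadric_ne_zero (mul_ne_zero n1 n2), cls_mul n1 n2, e1, e2]
  simp [crossBrackets, comb_cons, comb_nil]
  abel

theorem cls_one_sub_cross : cls (1 - rr 2 4 / rr 3 4) = comb brL oneSubCrossBrackets := by
  have n3 : rr 3 4 ≠ 0 := rr_succ_ne_zero (i := 3) (by simp)
  have n2 : rr 2 3 ≠ 0 := rr_succ_ne_zero (i := 2) (by simp)
  have h : 1 - rr 2 4 / rr 3 4 = -(rr 2 3 / rr 3 4) := by
    rw [one_sub_div n3, ← neg_div]
    congr 1
    simp only [rr]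
    ring
  rw [h, cls_neg, cls_div n2 n3, cls_rr_succ (i := 3) (by simp), cls_rr_succ (i := 2) (by simp)]
  simp [oneSubCrossBrackets, comb_cons, comb_nil]
  abel

theorem Alt_quad_add_fst (a a' b c d : VF K4) :
    Alt (quad (a + a') b c d) = Alt (quad a b c d) + Alt (quad a' b c d) := by
  simp only [← altLin_apply, ← quadFst_apply, map_add]

theorem Alt_quad_add_snd (a b b' c d : VF K4) :
    Alt (quad a (b + b') c d) = Alt (quad a b c d) + Alt (quad a b' c d) := by
  simp only [← altLin_apply, ← quadSnd_apply, map_add]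

theorem Alt_sub {n : ℕ} (x y : TP K4 n) : Alt (x - y) = Alt x - Alt y := by
  simp only [← altLin_apply, map_sub]

theorem Alt_quad_quadric_fst :
    Alt (quad (cls quadric) (comb brL oneSubCrossBrackets) (comb brL diffBrackets)
      (comb brL ratioBrackets)) = 0 := by
  rw [Alt_quad_comb_snd]
  refine comb_eq_zero _ fun x hx => ?_
  rw [Alt_quad_comb_trd]
  refine comb_eq_zero _ fun y hy => ?_
  rw [Alt_quad_comb_fth]
  exact comb_eq_zero _ fun z hz => (Alt_quad_quadric_eq_zero hx hy hz).1

theorem Alt_quad_quadric_snd :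
    Alt (quad (comb brL oneSubCrossBrackets) (cls quadric) (comb brL diffBrackets)
      (comb brL ratioBrackets)) = 0 := by
  rw [Alt_quad_comb_fst]
  refine comb_eq_zero _ fun x hx => ?_
  rw [Alt_quad_comb_trd]
  refine comb_eq_zero _ fun y hy => ?_
  rw [Alt_quad_comb_fth]
  exact comb_eq_zero _ fun z hz => (Alt_quad_quadric_eq_zero hx hy hz).2

theorem Alt_cross :
    Alt (quad (cls (rr 2 4 / rr 3 4)) (cls (1 - rr 2 4 / rr 3 4)) (cls (rr 1 2))
        (cls (rho 1 / rho 4)) -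
      quad (cls (1 - rr 2 4 / rr 3 4)) (cls (rr 2 4 / rr 3 4)) (cls (rr 1 2))
        (cls (rho 1 / rho 4))) =
    comb altWord (subWords
      (tensorWords crossBrackets oneSubCrossBrackets diffBrackets ratioBrackets)
      (tensorWords oneSubCrossBrackets crossBrackets diffBrackets ratioBrackets)) := by
  rw [comb_subWords, comb_tensorWords, comb_tensorWords, Alt_sub, cls_cross, cls_one_sub_cross,
    cls_rr_one_two, cls_rho_div, Alt_quad_add_fst, Alt_quad_add_snd, Alt_quad_quadric_fst,
    Alt_quad_quadric_snd, zero_add, zero_add]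

theorem Alt_Pit_quad_brL (a b c d : List ℕ) :
    (7 : ℚ) • Alt (Pit 4 (quad (brL a) (brL b) (brL c) (brL d))) =
      comb altWord (projectedWords a b c d) := by
  rw [Pit_quad]
  simp only [Alt_sub, projectedWords, comb_cons, comb_nil, altWord_pointWords, smul_sub]
  push_cast
  simp only [neg_smul]
  abel

theorem length_le_of_mem_differenceWords {p : ℤ × List ℕ} (h : p ∈ differenceWords) :
    p.2.length ≤ 8 := by
  simp only [differenceWords, subWords, List.mem_append, List.mem_map] at h
  rcases h with h | ⟨q, h | ⟨r, h, rfl⟩, rfl⟩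
  · simp only [projectedWords, List.mem_cons, List.not_mem_nil, or_false] at h
    rcases h with rfl | rfl | rfl | rfl | rfl | rfl | rfl | rfl <;> simp [pointWords]
  · exact length_of_mem_tensorWords (p := q) h
  · exact length_of_mem_tensorWords (p := r) h

theorem comb_differenceWords : comb altWord differenceWords = 0 := by
  rw [← comb_collect altWord _ fun p hp => altWord_signedSort (length_le_of_mem_differenceWords hp)]
  exact comb_eq_zero_of_allZero _ allZero_differenceWords

theorem tp4_eq_quad (a b c d : VF K4) : tp4 a b c d = quad a b c d := rfl

theorem seven_smul_Alt_Pit :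
    (7 : ℚ) • Alt (Pit 4 (quad (cls (d4 1 2 3 4)) (cls (d4 2 3 4 5)) (cls (d4 3 4 5 6))
      (cls (d4 4 5 6 7)))) =
    Alt (quad (cls (rr 2 4 / rr 3 4)) (cls (1 - rr 2 4 / rr 3 4)) (cls (rr 1 2))
        (cls (rho 1 / rho 4)) -
      quad (cls (1 - rr 2 4 / rr 3 4)) (cls (rr 2 4 / rr 3 4)) (cls (rr 1 2))
        (cls (rho 1 / rho 4))) := by
  rw [(cls_d4_of_lt (a := 1) (b := 2) (c := 3) (d := 4) (by simp)).2,
    (cls_d4_of_lt (a := 2) (b := 3) (c := 4) (d := 5) (by simp)).2,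
    (cls_d4_of_lt (a := 3) (b := 4) (c := 5) (d := 6) (by simp)).2,
    (cls_d4_of_lt (a := 4) (b := 5) (c := 6) (d := 7) (by simp)).2, Alt_Pit_quad_brL, Alt_cross,
    ← sub_eq_zero, ← comb_subWords]
  exact comb_differenceWords

end

end GrassPoly

open GrassPoly

/-- Lemma `gr4li2`:
`(7/144)·S^⧢(Gr₄) = 8·Alt₈[([u]⊗[1-u] - [1-u]⊗[u]) ⊗ [ρ₁₂] ⊗ [ρ₁/ρ₄]]`
with `u = ρ₂₄/ρ₃₄`. -/
theorem gr4_li2_formula :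
    ((7 : ℚ) / 144) • Pit 4 SGr4 =
      (8 : ℚ) • Alt (
        tp4 (cls (rr 2 4 / rr 3 4)) (cls (1 - rr 2 4 / rr 3 4))
            (cls (rr 1 2)) (cls (rho 1 / rho 4))
        - tp4 (cls (1 - rr 2 4 / rr 3 4)) (cls (rr 2 4 / rr 3 4))
            (cls (rr 1 2)) (cls (rho 1 / rho 4))) := by
  have h4 : SGr4 = ((2 : ℚ) * ((Nat.factorial 4 : ℚ)) ^ 2) • Alt (quad (cls (d4 1 2 3 4))
      (cls (d4 2 3 4 5)) (cls (d4 3 4 5 6)) (cls (d4 4 5 6 7))) := rfl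
  have hc : (7 : ℚ) / 144 * (2 * (Nat.factorial 4 : ℚ) ^ 2) = 8 * 7 := by norm_num [Nat.factorial]
  rw [tp4_eq_quad, tp4_eq_quad, ← seven_smul_Alt_Pit, h4, map_smul, Pit_Alt_quad, smul_smul,
    smul_smul, hc]
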